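/- Let M₁,…,M_s be m×m real symmetric positive semidefinite matrices and N a positive integer, and let D = {n ∈ ℕ^s : Σ_i n_i ≤ N} be the (finite) set of feasible designs. There exists p₀ ∈ (0,1] such that for every p ∈ (0,p₀) and every n* ∈ D maximizing φ_p(n) = trace((Σ_{i=1}^s n_i M_i)^p) over D, the design n* maximizes rank(Σ_{i=1}^s n_i M_i) over D, and moreover, among all designs in D attaining this maximal rank, n* maximizes the product of the nonzero eigenvalues of Σ_{i=1}^s n_i M_i. -/

import Mathlib

open Matrix in
/-- Applying a real function to a real symmetric matrix via the spectral
decomposition: `f(A) = U Diag(f(λ₁),…,f(λ_m)) Uᵀ`. Junk value `0` on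
non-symmetric input. -/
noncomputable def matFun (f : ℝ → ℝ) {m : ℕ} (A : Matrix (Fin m) (Fin m) ℝ) :
    Matrix (Fin m) (Fin m) ℝ :=
  if hA : A.IsHermitian then
    (hA.eigenvectorUnitary : Matrix (Fin m) (Fin m) ℝ) *
      Matrix.diagonal (fun i => f (hA.eigenvalues i)) *
      star (hA.eigenvectorUnitary : Matrix (Fin m) (Fin m) ℝ)
  else 0

/-- `φ_p(S) = trace (∑_{i∈S} M_i)^p` for a subset `S` of `{1,…,s}`. -/
noncomputable def phiSet (p : ℝ) {m s : ℕ} (M : Fin s → Matrix (Fin m) (Fin m) ℝ)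
    (S : Finset (Fin s)) : ℝ :=
  (matFun (fun x => Real.rpow x p) (∑ i ∈ S, M i)).trace

/-- `φ_p(w) = trace (∑_{i=1}^s w_i M_i)^p` for a weight vector `w`. -/
noncomputable def phiW (p : ℝ) {m s : ℕ} (M : Fin s → Matrix (Fin m) (Fin m) ℝ)
    (w : Fin s → ℝ) : ℝ :=
  (matFun (fun x => Real.rpow x p) (∑ i, w i • M i)).trace

/-- The pseudo-determinant of a symmetric matrix: the product of its nonzero
eigenvalues (equal to `1` for the zero matrix); junk value `1` on
non-symmetric input. -/
noncomputable def pseudoDet {m : ℕ} (A : Matrix (Fin m) (Fin m) ℝ) : ℝ :=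
  if hA : A.IsHermitian then
    ∏ i ∈ Finset.univ.filter (fun i => hA.eigenvalues i ≠ 0), hA.eigenvalues i
  else 1

open Filter Topology

/-- The sum of the `p`-th powers of the nonzero eigenvalues. -/
noncomputable def powerSum {m : ℕ} {A : Matrix (Fin m) (Fin m) ℝ} (hA : A.IsHermitian)
    (p : ℝ) : ℝ :=
  ∑ i ∈ Finset.univ.filter (fun i => hA.eigenvalues i ≠ 0), hA.eigenvalues i ^ p

theorem trace_matFun {m : ℕ} {A : Matrix (Fin m) (Fin m) ℝ} (hA : A.IsHermitian)
    (f : ℝ → ℝ) : (matFun f A).trace = ∑ i, f (hA.eigenvalues i) := by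
  rw [matFun, dif_pos hA, Matrix.trace_mul_cycle, Unitary.coe_star_mul_self, one_mul,
    Matrix.trace_diagonal]

theorem trace_matFun_rpow {m : ℕ} {A : Matrix (Fin m) (Fin m) ℝ} (hA : A.IsHermitian)
    {p : ℝ} (hp : p ≠ 0) :
    (matFun (fun x => Real.rpow x p) A).trace = powerSum hA p := by
  rw [trace_matFun hA, powerSum, Finset.sum_filter_of_ne]
  · rfl
  · intro i _ h h0
    exact h (by rw [h0, Real.zero_rpow hp])

theorem powerSum_zero {m : ℕ} {A : Matrix (Fin m) (Fin m) ℝ} (hA : A.IsHermitian) :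
    powerSum hA 0 = A.rank := by
  rw [hA.rank_eq_card_non_zero_eigs, Fintype.card_subtype]
  simp [powerSum]

theorem hasDerivAt_powerSum_zero {m : ℕ} {A : Matrix (Fin m) (Fin m) ℝ}
    (hA : A.PosSemidef) :
    HasDerivAt (powerSum hA.isHermitian) (Real.log (pseudoDet A)) 0 := by
  rw [pseudoDet, dif_pos hA.isHermitian,
    Real.log_prod (fun i hi => (Finset.mem_filter.mp hi).2)]
  refine HasDerivAt.fun_sum fun i hi => ?_
  have hpos : 0 < hA.isHermitian.eigenvalues i :=
    (hA.eigenvalues_nonneg i).lt_of_ne' (Finset.mem_filter.mp hi).2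
  simpa using (hasDerivAt_id (0 : ℝ)).const_rpow hpos

theorem pseudoDet_pos {m : ℕ} {A : Matrix (Fin m) (Fin m) ℝ} (hA : A.PosSemidef) :
    0 < pseudoDet A := by
  rw [pseudoDet, dif_pos hA.isHermitian]
  exact Finset.prod_pos fun i hi =>
    (hA.eigenvalues_nonneg i).lt_of_ne' (Finset.mem_filter.mp hi).2

theorem eventually_trace_rpow_lt_of_rank_lt {m : ℕ} {A B : Matrix (Fin m) (Fin m) ℝ}
    (hA : A.PosSemidef) (hB : B.PosSemidef) (h : A.rank < B.rank) :
    ∀ᶠ p in 𝓝[>] (0 : ℝ), (matFun (fun x => Real.rpow x p) A).trace <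
      (matFun (fun x => Real.rpow x p) B).trace := by
  have key : ∀ᶠ p in 𝓝 (0 : ℝ), powerSum hA.isHermitian p < powerSum hB.isHermitian p :=
    (hasDerivAt_powerSum_zero hA).continuousAt.eventually_lt
      (hasDerivAt_powerSum_zero hB).continuousAt
      (by rw [powerSum_zero, powerSum_zero]; exact_mod_cast h)
  filter_upwards [nhdsWithin_le_nhds key, self_mem_nhdsWithin] with p hp h0
  rwa [trace_matFun_rpow hA.isHermitian (ne_of_gt h0),
    trace_matFun_rpow hB.isHermitian (ne_of_gt h0)]

theorem eventually_trace_rpow_lt_of_pseudoDet_lt {m : ℕ} {A B : Matrix (Fin m) (Fin m) ℝ}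
    (hA : A.PosSemidef) (hB : B.PosSemidef) (hr : A.rank = B.rank)
    (h : pseudoDet A < pseudoDet B) :
    ∀ᶠ p in 𝓝[>] (0 : ℝ), (matFun (fun x => Real.rpow x p) A).trace <
      (matFun (fun x => Real.rpow x p) B).trace := by
  have hd := (hasDerivAt_powerSum_zero hB).sub (hasDerivAt_powerSum_zero hA)
  have hslope := hd.tendsto_slope.mono_left
    (nhdsWithin_mono _ fun x (hx : 0 < x) => ne_of_gt hx)
  have hpos := hslope.eventually_const_lt
    (sub_pos.mpr (Real.log_lt_log (pseudoDet_pos hA) h))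
  filter_upwards [hpos, self_mem_nhdsWithin] with p hp h0
  rw [trace_matFun_rpow hA.isHermitian (ne_of_gt h0),
    trace_matFun_rpow hB.isHermitian (ne_of_gt h0)]
  rw [slope_def_field, Pi.sub_apply, Pi.sub_apply, powerSum_zero, powerSum_zero, hr,
    sub_self, sub_zero, sub_zero] at hp
  exact sub_pos.mp ((div_pos_iff_of_pos_right h0).mp hp)

theorem finite_setOf_sum_le (s N : ℕ) : {n : Fin s → ℕ | ∑ i, n i ≤ N}.Finite :=
  (Set.finite_Iic (fun _ : Fin s => N)).subset fun _ hn i =>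
    (Finset.single_le_sum (fun _ _ => Nat.zero_le _) (Finset.mem_univ i)).trans hn

/-- For `p > 0` small enough, every design `n*` maximizing
`φ_p` over `D = {n ∈ ℕ^s : ∑ n_i ≤ N}` maximizes the rank of `∑ n_i M_i` over
`D`, and, among all designs in `D` of maximal rank, maximizes the product of
the nonzero eigenvalues of `∑ n_i M_i`. -/
theorem phi_small_p_maximizes_rank_and_pseudoDet
    (m s N : ℕ) (hN : 0 < N)
    (M : Fin s → Matrix (Fin m) (Fin m) ℝ) (hM : ∀ i, (M i).PosSemidef) :
    ∃ p₀ ∈ Set.Ioc (0 : ℝ) 1, ∀ p ∈ Set.Ioo (0 : ℝ) p₀,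
      ∀ n : Fin s → ℕ, (∑ i, n i ≤ N) →
        (∀ n' : Fin s → ℕ, (∑ i, n' i ≤ N) →
          phiW p M (fun i => (n' i : ℝ)) ≤ phiW p M (fun i => (n i : ℝ))) →
        ((∀ n' : Fin s → ℕ, (∑ i, n' i ≤ N) →
            (∑ i, (n' i : ℝ) • M i).rank ≤ (∑ i, (n i : ℝ) • M i).rank) ∧
          (∀ n' : Fin s → ℕ, (∑ i, n' i ≤ N) →
            (∑ i, (n' i : ℝ) • M i).rank = (∑ i, (n i : ℝ) • M i).rank →
              pseudoDet (∑ i, (n' i : ℝ) • M i) ≤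
                pseudoDet (∑ i, (n i : ℝ) • M i))) := by
  have hpsd (n : Fin s → ℕ) : (∑ i, (n i : ℝ) • M i).PosSemidef :=
    Matrix.posSemidef_sum _ fun i _ => (hM i).smul (Nat.cast_nonneg _)
  have hfin := finite_setOf_sum_le s N
  have hev : ∀ᶠ p in 𝓝[>] (0 : ℝ), ∀ n ∈ {n : Fin s → ℕ | ∑ i, n i ≤ N},
      ∀ n' ∈ {n : Fin s → ℕ | ∑ i, n i ≤ N},
      ((∑ i, (n i : ℝ) • M i).rank < (∑ i, (n' i : ℝ) • M i).rank ∨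
        (∑ i, (n i : ℝ) • M i).rank = (∑ i, (n' i : ℝ) • M i).rank ∧
          pseudoDet (∑ i, (n i : ℝ) • M i) < pseudoDet (∑ i, (n' i : ℝ) • M i)) →
      phiW p M (fun i => (n i : ℝ)) < phiW p M (fun i => (n' i : ℝ)) := by
    refine (eventually_all_finite hfin).2 fun n _ =>
      (eventually_all_finite hfin).2 fun n' _ => eventually_imp_distrib_left.2 ?_
    rintro (h | ⟨hr, h⟩)
    · exact eventually_trace_rpow_lt_of_rank_lt (hpsd n) (hpsd n') h
    · exact eventually_trace_rpow_lt_of_pseudoDet_lt (hpsd n) (hpsd n') hr h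
  obtain ⟨u, hu, hsub⟩ := mem_nhdsGT_iff_exists_Ioo_subset.1 hev
  refine ⟨min u 1, ⟨lt_min hu one_pos, min_le_right _ _⟩, fun p hp n hn hmax => ?_⟩
  have hlt := hsub ⟨hp.1, hp.2.trans_le (min_le_left _ _)⟩ n hn
  refine ⟨fun n' hn' => ?_, fun n' hn' hr => ?_⟩
  · by_contra! h
    exact (hlt n' hn' (.inl h)).not_ge (hmax n' hn')
  · by_contra! h
    exact (hlt n' hn' (.inr ⟨hr.symm, h⟩)).not_ge (hmax n' hn')
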